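/- arXiv:2601.21710 — 6 statements merged into one kernel-verified Lean document; each statement's English description precedes it below -/
import Mathlib

section
/- For every n, the sets F_k^n for 1 ≤ k ≤ ⌈n/2⌉ are pairwise disjoint, and their union equals Γ^n, the set of all n-vertex digraphs admitting no Hamiltonian decomposition. -/
open Finset Filter

/-- A matching in the bipartite representation of a digraph on `Fin n`:
a set of edges no two of which share a left endpoint or share a right endpoint. -/
def IsMatching (n : ℕ) (M : Finset (Fin n × Fin n)) : Prop :=
  ∀ e ∈ M, ∀ f ∈ M, (e.1 = f.1 ∨ e.2 = f.2) → e = f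

/-- `M` is a maximum matching of the bipartite representation of the digraph
with edge set `E`. -/
def IsMaxMatching (n : ℕ) (E M : Finset (Fin n × Fin n)) : Prop :=
  M ⊆ E ∧ IsMatching n M ∧ ∀ M' ⊆ E, IsMatching n M' → M'.card ≤ M.card

/-- The digraph `(V, M)` is a disjoint union of directed cycles and isolated
vertices: `M` is the graph of a permutation restricted to an invariant set `S`,
all vertices outside `S` being isolated. -/
def CyclesAndIsolated (n : ℕ) (M : Finset (Fin n × Fin n)) : Prop :=
  ∃ σ : Equiv.Perm (Fin n), ∃ S : Finset (Fin n),
    (∀ u ∈ S, σ u ∈ S) ∧ M = S.image fun u => (u, σ u)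

/-- A digraph is structurally diagonalizable if its bipartite representation has a
maximum matching `M` such that `(V, M)` is a disjoint union of directed cycles
and isolated vertices. -/
def StructurallyDiagonalizable (n : ℕ) (E : Finset (Fin n × Fin n)) : Prop :=
  ∃ M, IsMaxMatching n E M ∧ CyclesAndIsolated n M

/-- A Hamiltonian decomposition: a spanning subgraph that is a disjoint union of
directed cycles covering all `n` vertices, i.e. the functional graph of a
permutation contained in `E`. -/
def HasHamiltonianDecomposition (n : ℕ) (E : Finset (Fin n × Fin n)) : Prop :=
  ∃ σ : Equiv.Perm (Fin n), ∀ u, (u, σ u) ∈ E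

/-- A consistent matching of the bipartite representation of `E`: a matching whose
set of left endpoints equals its set of right endpoints. -/
def IsConsistentMatching (n : ℕ) (E M : Finset (Fin n × Fin n)) : Prop :=
  M ⊆ E ∧ IsMatching n M ∧ M.image Prod.fst = M.image Prod.snd

/-- Neighborhood, on the right side, of a set `I` of left vertices of `B(G)`. -/
def leftNbhd (n : ℕ) (E : Finset (Fin n × Fin n)) (I : Finset (Fin n)) :
    Finset (Fin n) :=
  Finset.univ.filter fun v => ∃ u ∈ I, (u, v) ∈ E

/-- Neighborhood, on the left side, of a set `I` of right vertices of `B(G)`. -/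
def rightNbhd (n : ℕ) (E : Finset (Fin n × Fin n)) (I : Finset (Fin n)) :
    Finset (Fin n) :=
  Finset.univ.filter fun u => ∃ v ∈ I, (u, v) ∈ E

/-- Membership in `F_k^n`: (1) some subset `I` of one side of `B(G)` has `|I| = k`
and `|N(I)| = k - 1`; (2) no subset `J` of either side with `|J| < k` satisfies
`|N(J)| = |J| - 1`. -/
def memF (n k : ℕ) (E : Finset (Fin n × Fin n)) : Prop :=
  (∃ I : Finset (Fin n), I.card = k ∧
      ((leftNbhd n E I).card + 1 = k ∨ (rightNbhd n E I).card + 1 = k)) ∧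
  ∀ J : Finset (Fin n), J.card < k →
      (leftNbhd n E J).card + 1 ≠ J.card ∧ (rightNbhd n E J).card + 1 ≠ J.card

/-- Membership in `L_k^n`: the bipartite representation of `E` admits a maximum
matching of size `n - k` that decomposes the digraph into disjoint cycles and
isolated vertices. -/
def memL (n k : ℕ) (E : Finset (Fin n × Fin n)) : Prop :=
  ∃ M, IsMaxMatching n E M ∧ M.card = n - k ∧ CyclesAndIsolated n M

/-- The probability, under the random digraph model `G(n, p, q)` (each non-loop
edge present independently with probability `p`, each self-loop with
probability `q`), that the sampled digraph lies in the set `A`. -/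
noncomputable def digraphProb (n : ℕ) (p q : ℝ)
    (A : Set (Finset (Fin n × Fin n))) : ℝ :=
  ∑ E : Finset (Fin n × Fin n),
    Set.indicator A (fun E =>
      (∏ e ∈ E, if e.1 = e.2 then q else p) *
      ∏ e ∈ Finset.univ \ E, if e.1 = e.2 then 1 - q else 1 - p) E

/-- A finite set whose image under a monotone set function is smaller than itself contains
a subset whose image is smaller by exactly one. -/
theorem exists_subset_card_add_one_eq_of_card_lt {α β : Type*} {f : Finset α → Finset β}
    (hf : Monotone f) (A : Finset α) (hA : (f A).card < A.card) :
    ∃ J ⊆ A, (f J).card + 1 = J.card := by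
  classical
  induction A using Finset.strongInduction with
  | H A ih =>
    by_cases h : (f A).card + 1 = A.card
    · exact ⟨A, subset_rfl, h⟩
    · obtain ⟨a, ha⟩ : A.Nonempty := Finset.card_pos.mp (by omega)
      have hle := Finset.card_le_card (hf (Finset.erase_subset a A))
      have hcard := Finset.card_erase_of_mem ha
      obtain ⟨J, hJ, hJc⟩ := ih _ (Finset.erase_ssubset ha) (by omega)
      exact ⟨J, hJ.trans (Finset.erase_subset a A), hJc⟩

theorem leftNbhd_mono (n : ℕ) (E : Finset (Fin n × Fin n)) : Monotone (leftNbhd n E) := by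
  intro I J h v hv
  simp only [leftNbhd, Finset.mem_filter, Finset.mem_univ, true_and] at hv ⊢
  exact hv.imp fun u hu => ⟨h hu.1, hu.2⟩

theorem rightNbhd_mono (n : ℕ) (E : Finset (Fin n × Fin n)) : Monotone (rightNbhd n E) := by
  intro I J h u hu
  simp only [rightNbhd, Finset.mem_filter, Finset.mem_univ, true_and] at hu ⊢
  exact hu.imp fun v hv => ⟨h hv.1, hv.2⟩

theorem rightNbhd_compl_leftNbhd_subset (n : ℕ) (E : Finset (Fin n × Fin n))
    (A : Finset (Fin n)) : rightNbhd n E (leftNbhd n E A)ᶜ ⊆ Aᶜ := by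
  intro u hu
  simp only [rightNbhd, leftNbhd, Finset.mem_filter, Finset.mem_univ, true_and,
    Finset.mem_compl] at hu ⊢
  obtain ⟨v, hv, huv⟩ := hu
  exact fun hA => hv ⟨u, hA, huv⟩

/-- Hall's marriage theorem for Hamiltonian decompositions. -/
theorem hasHamiltonianDecomposition_iff_card_le_leftNbhd (n : ℕ) (E : Finset (Fin n × Fin n)) :
    HasHamiltonianDecomposition n E ↔ ∀ A, A.card ≤ (leftNbhd n E A).card := by
  have hall : (∀ A, A.card ≤ (leftNbhd n E A).card) ↔
      ∃ f : Fin n → Fin n, Function.Injective f ∧ ∀ u, (u, f u) ∈ E := by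
    convert Fintype.all_card_le_filter_rel_iff_exists_injective
      (fun u v : Fin n => (u, v) ∈ E) using 4
    unfold leftNbhd
    congr!
  refine Iff.trans ?_ hall.symm
  constructor
  · rintro ⟨σ, hσ⟩
    exact ⟨σ, σ.injective, hσ⟩
  · rintro ⟨f, hf, hfE⟩
    exact ⟨Equiv.ofBijective f (Finite.injective_iff_bijective.mp hf), hfE⟩

theorem HasHamiltonianDecomposition.card_le_rightNbhd {n : ℕ} {E : Finset (Fin n × Fin n)}
    (h : HasHamiltonianDecomposition n E) (A : Finset (Fin n)) :
    A.card ≤ (rightNbhd n E A).card := by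
  obtain ⟨σ, hσ⟩ := h
  refine Finset.card_le_card_of_injOn σ.symm (fun v hv => ?_) σ.symm.injective.injOn
  simp only [rightNbhd, Finset.coe_filter, Finset.mem_univ, true_and, Set.mem_ofPred_eq]
  exact ⟨v, hv, by simpa using hσ (σ.symm v)⟩

/-- Without a Hamiltonian decomposition, one side has a set of at most `⌈n/2⌉` vertices
whose neighborhood is smaller by exactly one. -/
theorem exists_deficient_of_not_hasHamiltonianDecomposition {n : ℕ}
    {E : Finset (Fin n × Fin n)} (h : ¬ HasHamiltonianDecomposition n E) :
    ∃ J : Finset (Fin n), J.card ≤ (n + 1) / 2 ∧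
      ((leftNbhd n E J).card + 1 = J.card ∨ (rightNbhd n E J).card + 1 = J.card) := by
  rw [hasHamiltonianDecomposition_iff_card_le_leftNbhd] at h
  push Not at h
  obtain ⟨A, hA⟩ := h
  obtain ⟨J, -, hJ⟩ := exists_subset_card_add_one_eq_of_card_lt (leftNbhd_mono n E) A hA
  by_cases hle : J.card ≤ (n + 1) / 2
  · exact ⟨J, hle, Or.inl hJ⟩
  · have hN := Finset.card_le_card (rightNbhd_compl_leftNbhd_subset n E J)
    have hJn := Finset.card_le_univ J
    have hc := Finset.card_compl (leftNbhd n E J)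
    rw [Finset.card_compl] at hN
    rw [Fintype.card_fin] at hN hJn hc
    obtain ⟨K, hK, hKc⟩ := exists_subset_card_add_one_eq_of_card_lt (rightNbhd_mono n E)
      (leftNbhd n E J)ᶜ (by omega)
    have hKle := Finset.card_le_card hK
    exact ⟨K, by omega, Or.inr hKc⟩

theorem memF.le {n k l : ℕ} {E : Finset (Fin n × Fin n)} (hk : memF n k E)
    (hl : memF n l E) : l ≤ k := by
  obtain ⟨⟨I, rfl, hI⟩, -⟩ := hk
  by_contra! hlt
  have := hl.2 I hlt
  exact hI.elim this.1 this.2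

/-- The sets `F_k^n`, `1 ≤ k ≤ ⌈n/2⌉`, are pairwise disjoint and
their union is `Γ^n`, the set of `n`-vertex digraphs with no Hamiltonian
decomposition. -/
theorem memF_pairwise_disjoint_and_union_eq_noHD (n : ℕ) :
    (∀ E : Finset (Fin n × Fin n), ∀ k ∈ Finset.Icc 1 ((n + 1) / 2),
        ∀ l ∈ Finset.Icc 1 ((n + 1) / 2), memF n k E → memF n l E → k = l) ∧
    (∀ E : Finset (Fin n × Fin n),
        (∃ k ∈ Finset.Icc 1 ((n + 1) / 2), memF n k E) ↔
          ¬ HasHamiltonianDecomposition n E) := by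
  refine ⟨fun E k _ l _ hk hl => le_antisymm (hl.le hk) (hk.le hl), fun E => ⟨?_, fun h => ?_⟩⟩
  · rintro ⟨k, -, ⟨I, rfl, hI⟩, -⟩ h
    have hL := (hasHamiltonianDecomposition_iff_card_le_leftNbhd n E).mp h I
    have hR := h.card_le_rightNbhd I
    omega
  · classical
    obtain ⟨J, hJ, hJd⟩ := exists_deficient_of_not_hasHamiltonianDecomposition h
    have hex : ∃ k, ∃ I : Finset (Fin n), I.card = k ∧
        ((leftNbhd n E I).card + 1 = k ∨ (rightNbhd n E I).card + 1 = k) :=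
      ⟨J.card, J, rfl, hJd⟩
    have hle : Nat.find hex ≤ J.card := Nat.find_min' hex ⟨J, rfl, hJd⟩
    refine ⟨Nat.find hex, Finset.mem_Icc.mpr ⟨?_, hle.trans hJ⟩, Nat.find_spec hex, ?_⟩
    · obtain ⟨I, -, hI⟩ := Nat.find_spec hex
      omega
    · intro I hI
      have hmin := Nat.find_min hex hI
      exact ⟨fun hL => hmin ⟨I, rfl, Or.inl hL⟩, fun hR => hmin ⟨I, rfl, Or.inr hR⟩⟩
end

section
/- Let k ≥ 2 and let G be an n-vertex digraph in F_k^n, and let I be a subset of one side of B(G) with |I| = k and |N(I)| = k − 1 (as in condition (1) of the definition of F_k^n). Then every vertex of N(I) is adjacent in B(G) to at least two vertices of I. -/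
open Finset Filter

/-- If a monotone set function `N` takes a value smaller than its argument `J`, some subset
of `J` is larger than its image by exactly one. -/
theorem exists_subset_card_succ_eq {α β : Type*} [DecidableEq α]
    (N : Finset α → Finset β) (hN : Monotone N) (J : Finset α)
    (hJ : (N J).card + 1 ≤ J.card) : ∃ K ⊆ J, (N K).card + 1 = K.card := by
  induction J using Finset.induction_on with
  | empty => simp at hJ
  | insert a s ha ih =>
    by_cases hs : (N s).card + 1 ≤ s.card
    · obtain ⟨K, hK, h⟩ := ih hs
      exact ⟨K, hK.trans (Finset.subset_insert a s), h⟩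
    · have hle := Finset.card_le_card (hN (Finset.subset_insert a s))
      have hcard := Finset.card_insert_of_notMem ha
      exact ⟨insert a s, Finset.Subset.refl _, by omega⟩

/-- If no set with fewer than `|I|` elements exceeds its neighborhood by exactly one and `I` does,
then every neighbor of `I` has at least two neighbors in `I`. -/
theorem two_le_card_filter_of_minimal_deficient {α β : Type*} [DecidableEq α]
    [DecidableEq β] (r : α → β → Prop) [∀ a b, Decidable (r a b)] (N : Finset α → Finset β)
    (hN : ∀ J b, b ∈ N J ↔ ∃ a ∈ J, r a b) (I : Finset α) (hI : (N I).card + 1 = I.card)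
    (hmin : ∀ J : Finset α, J.card < I.card → (N J).card + 1 ≠ J.card)
    (b : β) (hb : b ∈ N I) : 2 ≤ (I.filter fun a => r a b).card := by
  by_contra! hlt
  have hmono : Monotone N := fun s t hst x hx => by
    obtain ⟨a, ha, hr⟩ := (hN s x).1 hx
    exact (hN t x).2 ⟨a, hst ha, hr⟩
  obtain ⟨a, haI, hab⟩ := (hN I b).1 hb
  have hsub : N (I.erase a) ⊆ (N I).erase b := fun x hx => by
    refine Finset.mem_erase.2 ⟨?_, hmono (Finset.erase_subset a I) hx⟩
    rintro rfl
    obtain ⟨c, hc, hcx⟩ := (hN _ _).1 hx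
    obtain ⟨hca, hcI⟩ := Finset.mem_erase.1 hc
    exact hca (Finset.card_le_one.1 (Nat.le_of_lt_succ hlt) c
      (Finset.mem_filter.2 ⟨hcI, hcx⟩) a (Finset.mem_filter.2 ⟨haI, hab⟩))
  have hle := Finset.card_le_card hsub
  have hNpos := Finset.card_pos.2 ⟨b, hb⟩
  rw [Finset.card_erase_of_mem hb] at hle
  have herase := Finset.card_erase_of_mem haI
  obtain ⟨K, hK, hKcard⟩ := exists_subset_card_succ_eq N hmono (I.erase a) (by omega)
  have hKle := Finset.card_le_card hK
  exact hmin K (by omega) hKcard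

/-- For `k ≥ 2` and `G ∈ F_k^n`, any witnessing set `I` on either side
(with `|I| = k` and `|N(I)| = k - 1`) has the property that every vertex of `N(I)`
is adjacent in `B(G)` to at least two vertices of `I`. -/
theorem memF_nbhd_two_neighbors
    (n k : ℕ) (hk : 2 ≤ k) (E : Finset (Fin n × Fin n)) (hG : memF n k E) :
    (∀ I : Finset (Fin n), I.card = k → (leftNbhd n E I).card + 1 = k →
        ∀ v ∈ leftNbhd n E I, 2 ≤ (I.filter fun u => (u, v) ∈ E).card) ∧
    (∀ I : Finset (Fin n), I.card = k → (rightNbhd n E I).card + 1 = k →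
        ∀ v ∈ rightNbhd n E I, 2 ≤ (I.filter fun u => (v, u) ∈ E).card) := by
  refine ⟨fun I hIk hI v hv => ?_, fun I hIk hI v hv => ?_⟩
  · exact two_le_card_filter_of_minimal_deficient (fun u v => (u, v) ∈ E) (leftNbhd n E)
      (by simp [leftNbhd]) I (hI.trans hIk.symm)
      (fun J hJ => (hG.2 J (hIk ▸ hJ)).1) v hv
  · exact two_le_card_filter_of_minimal_deficient (fun u v => (v, u) ∈ E) (rightNbhd n E)
      (by simp [rightNbhd]) I (hI.trans hIk.symm)
      (fun J hJ => (hG.2 J (hIk ▸ hJ)).2) v hv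
end

section
/- Let G be a digraph on n labeled vertices. If the bipartite representation B(G) has a consistent matching of size n or of size n−1, then G is structurally diagonalizable. -/
open Finset Filter

/-- A matching whose sets of left and right endpoints agree is a disjoint union of
directed cycles and isolated vertices. -/
lemma IsMatching.cyclesAndIsolated {n : ℕ} {M : Finset (Fin n × Fin n)}
    (hM : IsMatching n M) (hS : M.image Prod.fst = M.image Prod.snd) :
    CyclesAndIsolated n M := by
  classical
  have hmem : ∀ u, (∃ v, (u, v) ∈ M) ↔ ∃ w, (w, u) ∈ M := fun u => by
    have := Finset.ext_iff.mp hS u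
    simpa using this
  let f : Fin n → Fin n := fun u => if h : ∃ v, (u, v) ∈ M then h.choose else u
  have hf : ∀ {u}, (∃ v, (u, v) ∈ M) → (u, f u) ∈ M := fun {u} h => by
    simpa only [f, dif_pos h] using h.choose_spec
  have hf' : ∀ {u}, ¬ (∃ v, (u, v) ∈ M) → f u = u := fun {u} h => dif_neg h
  have hinj : Function.Injective f := by
    intro a b hab
    by_cases ha : ∃ v, (a, v) ∈ M <;> by_cases hb : ∃ v, (b, v) ∈ M
    · exact congrArg Prod.fst (hM _ (hf ha) _ (hf hb) (Or.inr hab))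
    · rw [hf' hb] at hab
      exact absurd ((hmem b).mpr ⟨a, hab ▸ hf ha⟩) hb
    · rw [hf' ha] at hab
      exact absurd ((hmem a).mpr ⟨b, hab ▸ hf hb⟩) ha
    · rwa [hf' ha, hf' hb] at hab
  refine ⟨Equiv.ofBijective f (Finite.injective_iff_bijective.mp hinj),
    M.image Prod.fst, fun u hu => ?_, ?_⟩
  · have hu' : ∃ v, (u, v) ∈ M := by simpa using hu
    rw [hS]
    exact Finset.mem_image_of_mem Prod.snd (hf hu')
  · ext ⟨a, b⟩
    simp only [Finset.mem_image, Equiv.ofBijective_apply, Prod.mk.injEq]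
    constructor
    · intro h
      exact ⟨a, ⟨_, h, rfl⟩, rfl,
        congrArg Prod.snd (hM _ (hf ⟨b, h⟩) _ h (Or.inl rfl))⟩
    · rintro ⟨_, ⟨⟨c, d⟩, h, rfl⟩, rfl, rfl⟩
      exact hf ⟨d, h⟩

lemma IsMatching.injOn_fst {n : ℕ} {M : Finset (Fin n × Fin n)} (hM : IsMatching n M) :
    Set.InjOn Prod.fst (M : Set (Fin n × Fin n)) :=
  fun e he f hf h => hM e he f hf (Or.inl h)

lemma IsMatching.injOn_snd {n : ℕ} {M : Finset (Fin n × Fin n)} (hM : IsMatching n M) :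
    Set.InjOn Prod.snd (M : Set (Fin n × Fin n)) :=
  fun e he f hf h => hM e he f hf (Or.inr h)

lemma IsMatching.card_le {n : ℕ} {M : Finset (Fin n × Fin n)} (hM : IsMatching n M) :
    M.card ≤ n := by
  simpa [Finset.card_image_of_injOn hM.injOn_fst] using (M.image Prod.fst).card_le_univ

/-- A perfect matching is consistent. -/
lemma IsMatching.image_fst_eq_image_snd {n : ℕ} {M : Finset (Fin n × Fin n)}
    (hM : IsMatching n M) (hc : M.card = n) : M.image Prod.fst = M.image Prod.snd := by
  have h₁ : M.image Prod.fst = Finset.univ := (Finset.card_eq_iff_eq_univ _).mp (by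
    rw [Finset.card_image_of_injOn hM.injOn_fst, hc, Fintype.card_fin])
  have h₂ : M.image Prod.snd = Finset.univ := (Finset.card_eq_iff_eq_univ _).mp (by
    rw [Finset.card_image_of_injOn hM.injOn_snd, hc, Fintype.card_fin])
  rw [h₁, h₂]

/-- If the bipartite representation of a digraph on `n` vertices has a
consistent matching of size `n` or `n - 1`, then the digraph is structurally
diagonalizable. -/
theorem consistentMatching_n_or_n_sub_one_structurallyDiagonalizable
    (n : ℕ) (E : Finset (Fin n × Fin n))
    (h : ∃ M, IsConsistentMatching n E M ∧ (M.card = n ∨ M.card = n - 1)) :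
    StructurallyDiagonalizable n E := by
  by_cases hp : ∃ M ⊆ E, IsMatching n M ∧ M.card = n
  · obtain ⟨M, hE, hM, hc⟩ := hp
    exact ⟨M, ⟨hE, hM, fun M' _ hM' => hM'.card_le.trans hc.ge⟩,
      hM.cyclesAndIsolated (hM.image_fst_eq_image_snd hc)⟩
  · obtain ⟨M, ⟨hE, hM, hS⟩, hc⟩ := h
    refine ⟨M, ⟨hE, hM, fun M' hE' hM' => ?_⟩, hM.cyclesAndIsolated hS⟩
    have hne : M'.card ≠ n := fun h => hp ⟨M', hE', hM', h⟩
    have hle := hM'.card_le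
    omega
end

section
/- Let G = (V,E) be a digraph on n labeled vertices whose bipartite representation B(G) admits a consistent matching M of size n−2, and let u, v be the two vertices of V not covered by M. Suppose that (i) u has no outgoing edges in G (the left copy of u is isolated in B(G)); (ii) v has no incoming edges in G (the right copy of v is isolated in B(G)); and (iii) there exists an edge (a,b) ∈ M such that (a,u) ∈ E and (v,b) ∈ E. Then G is not structurally diagonalizable. -/
open Finset Filter

/-- Augmenting a matching along the path `v → b ← a → u` gives a matching with one more edge. -/
theorem exists_isMatching_card_succ (n : ℕ) (E M : Finset (Fin n × Fin n)) (u v a b : Fin n)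
    (hME : M ⊆ E) (hM : IsMatching n M) (hu : u ∉ M.image Prod.snd)
    (hv : v ∉ M.image Prod.fst) (hab : (a, b) ∈ M) (hau : (a, u) ∈ E) (hvb : (v, b) ∈ E) :
    ∃ M' ⊆ E, IsMatching n M' ∧ M'.card = M.card + 1 := by
  have hu' : ∀ w, (w, u) ∉ M := fun w h => hu (Finset.mem_image_of_mem Prod.snd h)
  have hv' : ∀ w, (v, w) ∉ M := fun w h => hv (Finset.mem_image_of_mem Prod.fst h)
  have hfst : ∀ w, (a, w) ∈ M → w = b := fun w h =>
    congrArg Prod.snd (hM _ h _ hab (Or.inl rfl))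
  have hsnd : ∀ w, (w, b) ∈ M → w = a := fun w h =>
    congrArg Prod.fst (hM _ h _ hab (Or.inr rfl))
  have hva : v ≠ a := fun h => hv' b (h ▸ hab)
  have hub : u ≠ b := fun h => hu' a (h ▸ hab)
  refine ⟨insert (a, u) (insert (v, b) (M.erase (a, b))), ?_, ?_, ?_⟩
  · exact Finset.insert_subset hau
      (Finset.insert_subset hvb ((Finset.erase_subset _ _).trans hME))
  · rintro ⟨p, q⟩ he ⟨r, s⟩ hf h
    have hpq := hM (p, q)
    simp only [Finset.mem_insert, Finset.mem_erase, Prod.mk.injEq, ne_eq] at he hf h ⊢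
    grind
  · rw [Finset.card_insert_of_notMem, Finset.card_insert_of_notMem, Finset.card_erase_of_mem hab]
    · have := Finset.card_pos.mpr ⟨_, hab⟩
      omega
    · simp [hv']
    · simp [hu', hva.symm]

/-- A union of disjoint cycles misses every vertex without outgoing edges and every vertex
without incoming edges. -/
theorem CyclesAndIsolated.card_add_two_le (n : ℕ) (E N : Finset (Fin n × Fin n)) (u v : Fin n)
    (hN : CyclesAndIsolated n N) (hNE : N ⊆ E) (huv : u ≠ v)
    (huOut : ∀ w, (u, w) ∉ E) (hvIn : ∀ w, (w, v) ∉ E) : N.card + 2 ≤ n := by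
  obtain ⟨σ, S, hσ, rfl⟩ := hN
  have hE : ∀ w ∈ S, (w, σ w) ∈ E := fun w hw => hNE (Finset.mem_image_of_mem _ hw)
  have huS : u ∉ S := fun h => huOut _ (hE u h)
  have hvS : v ∉ S := by
    intro h
    obtain ⟨w, hw, hwv⟩ := Finset.surjOn_of_injOn_of_card_le σ
      (fun w hw => hσ w hw) σ.injective.injOn le_rfl h
    exact hvIn w (hwv ▸ hE w hw)
  calc (S.image fun w => (w, σ w)).card + 2 ≤ S.card + 2 :=
        Nat.add_le_add_right Finset.card_image_le 2
    _ = (insert u (insert v S)).card := by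
        rw [Finset.card_insert_of_notMem (by simp [huv, huS]), Finset.card_insert_of_notMem hvS]
    _ ≤ n := by simpa using Finset.card_le_univ (insert u (insert v S))

/-- If `B(G)` has a consistent matching `M` of size `n - 2` whose two
uncovered vertices `u, v` satisfy: `u` has no outgoing edges, `v` has no incoming
edges, and some edge `(a, b) ∈ M` has `(a, u) ∈ E` and `(v, b) ∈ E`, then `G` is
not structurally diagonalizable. -/
theorem not_structurallyDiagonalizable_of_blocked_consistentMatching
    (n : ℕ) (E M : Finset (Fin n × Fin n)) (u v : Fin n)
    (hM : IsConsistentMatching n E M) (hcard : M.card = n - 2)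
    (huv : u ≠ v) (hu : u ∉ M.image Prod.fst) (hv : v ∉ M.image Prod.fst)
    (huOut : ∀ w, (u, w) ∉ E) (hvIn : ∀ w, (w, v) ∉ E)
    (hab : ∃ a b, (a, b) ∈ M ∧ (a, u) ∈ E ∧ (v, b) ∈ E) :
    ¬ StructurallyDiagonalizable n E := by
  obtain ⟨hME, hMm, himg⟩ := hM
  obtain ⟨a, b, habM, hau, hvb⟩ := hab
  rintro ⟨N, ⟨hNE, -, hmax⟩, hN⟩
  obtain ⟨M', hM'E, hM', hM'card⟩ :=
    exists_isMatching_card_succ n E M u v a b hME hMm (himg ▸ hu) hv habM hau hvb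
  have hle := hN.card_add_two_le n E N u v hNE huv huOut hvIn
  have hge := hmax M' hM'E hM'
  omega
end

section
/- Let G = (V,E) be a digraph on n labeled vertices and 0 ≤ k ≤ n. Suppose the bipartite representation B(G) admits a consistent matching M of size n−k, and the k vertices of V not covered by M are isolated on one fixed side of B(G): either every such vertex has no outgoing edges in G, or every such vertex has no incoming edges in G. Then G is structurally diagonalizable. -/
open Finset Filter

theorem IsMatching.card_image_fst {n : ℕ} {M : Finset (Fin n × Fin n)} (hM : IsMatching n M) :
    (M.image Prod.fst).card = M.card :=
  Finset.card_image_of_injOn fun e he f hf h => hM e he f hf (Or.inl h)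

theorem IsMatching.card_image_snd {n : ℕ} {M : Finset (Fin n × Fin n)} (hM : IsMatching n M) :
    (M.image Prod.snd).card = M.card :=
  Finset.card_image_of_injOn fun e he f hf h => hM e he f hf (Or.inr h)

theorem IsConsistentMatching.cyclesAndIsolated {n : ℕ} {E M : Finset (Fin n × Fin n)}
    (hM : IsConsistentMatching n E M) : CyclesAndIsolated n M := by
  obtain ⟨-, hmatch, hends⟩ := hM
  have hsnd {u v : Fin n} (h : (u, v) ∈ M) : v ∈ M.image Prod.fst :=
    hends ▸ Finset.mem_image_of_mem Prod.snd h
  have hpartner : ∀ u, ∃ v, (u ∈ M.image Prod.fst → (u, v) ∈ M) ∧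
      (u ∉ M.image Prod.fst → v = u) := by
    intro u
    by_cases hu : u ∈ M.image Prod.fst
    · obtain ⟨⟨a, b⟩, he, rfl⟩ := Finset.mem_image.1 hu
      exact ⟨b, fun _ => he, fun h => absurd hu h⟩
    · exact ⟨u, fun h => absurd h hu, fun _ => rfl⟩
  choose f hf hfix using hpartner
  have hinj : Function.Injective f := by
    intro u v huv
    by_cases hu : u ∈ M.image Prod.fst <;> by_cases hv : v ∈ M.image Prod.fst
    · exact congrArg Prod.fst (hmatch _ (hf u hu) _ (hf v hv) (Or.inr huv))
    · exact absurd (hfix v hv ▸ huv ▸ hsnd (hf u hu)) hv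
    · exact absurd (hfix u hu ▸ huv.symm ▸ hsnd (hf v hv)) hu
    · rw [← hfix u hu, ← hfix v hv, huv]
  refine ⟨Equiv.ofBijective f (Finite.injective_iff_bijective.1 hinj), M.image Prod.fst,
    fun u hu => hsnd (hf u hu), ?_⟩
  ext ⟨u, v⟩
  simp only [Finset.mem_image (s := M.image Prod.fst), Equiv.ofBijective_apply, Prod.mk.injEq]
  constructor
  · intro h
    have hu : u ∈ M.image Prod.fst := Finset.mem_image_of_mem Prod.fst h
    exact ⟨u, hu, rfl, congrArg Prod.snd (hmatch _ (hf u hu) _ h (Or.inl rfl))⟩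
  · rintro ⟨w, hw, rfl, rfl⟩
    exact hf w hw

/-- A consistent matching is maximum as soon as its uncovered vertices are isolated on one fixed
side, since its vertex set is then a vertex cover of the bipartite representation. -/
theorem IsConsistentMatching.isMaxMatching {n : ℕ} {E M : Finset (Fin n × Fin n)}
    (hM : IsConsistentMatching n E M)
    (hiso : (∀ w, w ∉ M.image Prod.fst → ∀ x, (w, x) ∉ E) ∨
            (∀ w, w ∉ M.image Prod.fst → ∀ x, (x, w) ∉ E)) :
    IsMaxMatching n E M := by
  refine ⟨hM.1, hM.2.1, fun M' hM'E hM' => ?_⟩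
  rw [← hM.2.1.card_image_fst]
  rcases hiso with hiso | hiso
  · rw [← hM'.card_image_fst]
    refine Finset.card_le_card (Finset.image_subset_iff.2 fun e he => ?_)
    exact by_contra fun h => hiso e.1 h e.2 (hM'E he)
  · rw [← hM'.card_image_snd]
    refine Finset.card_le_card (Finset.image_subset_iff.2 fun e he => ?_)
    exact by_contra fun h => hiso e.2 h e.1 (hM'E he)

/-- If `B(G)` has a consistent matching `M` of size `n - k` and the
`k` uncovered vertices are all isolated on one fixed side of `B(G)` (all have no
outgoing edges, or all have no incoming edges), then `G` is structurally
diagonalizable. -/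
theorem consistentMatching_isolated_uncovered_structurallyDiagonalizable
    (n k : ℕ) (hk : k ≤ n) (E M : Finset (Fin n × Fin n))
    (hM : IsConsistentMatching n E M) (hcard : M.card = n - k)
    (hiso : (∀ w, w ∉ M.image Prod.fst → ∀ x, (w, x) ∉ E) ∨
            (∀ w, w ∉ M.image Prod.fst → ∀ x, (x, w) ∉ E)) :
    StructurallyDiagonalizable n E := by
  exact ⟨M, hM.isMaxMatching hiso, hM.cyclesAndIsolated⟩
end

section
/- Let c ∈ ℝ and let (p_n) be a sequence in [0,1] with n·p_n − log n → c. Then the probability that a digraph drawn from the random digraph model G(n, p_n) admits a Hamiltonian decomposition converges, as n → ∞, to e^{−2e^{−c}}. -/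
open Finset Filter

section BernoulliSubsets

variable {α β : Type*} [Fintype α] [DecidableEq α]

/-- The probability of the set `S` when each point is selected independently with
probability `p`. -/
def bernoulliWeight (p : ℝ) (S : Finset α) : ℝ :=
  ∏ x, if x ∈ S then p else 1 - p

open Classical in
/-- The probability that a random subset, each point of which is selected independently
with probability `p`, satisfies `P`. -/
noncomputable def bernoulliProb (p : ℝ) (P : Finset α → Prop) : ℝ :=
  ∑ S, bernoulliWeight p S * if P S then 1 else 0

/-- The row of index `a` of a subset of a product. -/
def rowOf [Fintype β] [DecidableEq β] (E : Finset (α × β)) (a : α) : Finset β :=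
  univ.filter fun b => (a, b) ∈ E

/-- The column of index `b` of a subset of a product. -/
def colOf [DecidableEq β] (E : Finset (α × β)) (b : β) : Finset α :=
  univ.filter fun a => (a, b) ∈ E

@[simp]
lemma mem_rowOf {α β : Type*} [DecidableEq α] [Fintype β] [DecidableEq β]
    {E : Finset (α × β)} {a : α} {b : β} : b ∈ rowOf E a ↔ (a, b) ∈ E := by
  simp [rowOf]

@[simp]
lemma mem_colOf [DecidableEq β] {E : Finset (α × β)} {a : α} {b : β} :
    a ∈ colOf E b ↔ (a, b) ∈ E := by
  simp [colOf]

lemma sum_prod_ite_mem (f g : α → ℝ) :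
    ∑ S : Finset α, ∏ x, (if x ∈ S then f x else g x) = ∏ x, (f x + g x) := by
  rw [prod_add, powerset_univ]
  refine sum_congr rfl fun S _ => ?_
  rw [prod_ite]
  congr 1 <;> refine prod_congr ?_ fun _ _ => rfl <;> ext <;> simp

lemma bernoulliWeight_nonneg {p : ℝ} (h0 : 0 ≤ p) (h1 : p ≤ 1) (S : Finset α) :
    0 ≤ bernoulliWeight p S :=
  prod_nonneg fun x _ => by split_ifs <;> linarith

lemma bernoulliProb_nonneg {p : ℝ} (h0 : 0 ≤ p) (h1 : p ≤ 1) (P : Finset α → Prop) :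
    0 ≤ bernoulliProb p P :=
  sum_nonneg fun S _ => mul_nonneg (bernoulliWeight_nonneg h0 h1 S) (by split_ifs <;> simp)

lemma bernoulliProb_mono {p : ℝ} (h0 : 0 ≤ p) (h1 : p ≤ 1) {P Q : Finset α → Prop}
    (h : ∀ S, P S → Q S) : bernoulliProb p P ≤ bernoulliProb p Q := by
  refine sum_le_sum fun S _ => mul_le_mul_of_nonneg_left ?_ (bernoulliWeight_nonneg h0 h1 S)
  by_cases hP : P S
  · simp [hP, h S hP]
  · by_cases hQ : Q S <;> simp [hP, hQ]

lemma bernoulliProb_or_le {p : ℝ} (h0 : 0 ≤ p) (h1 : p ≤ 1) (P Q : Finset α → Prop) :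
    bernoulliProb p (fun S => P S ∨ Q S) ≤ bernoulliProb p P + bernoulliProb p Q := by
  unfold bernoulliProb
  rw [← sum_add_distrib]
  refine sum_le_sum fun S _ => ?_
  rw [← mul_add]
  refine mul_le_mul_of_nonneg_left ?_ (bernoulliWeight_nonneg h0 h1 S)
  by_cases hP : P S <;> by_cases hQ : Q S <;> simp [hP, hQ]

lemma bernoulliProb_exists_le {ι : Type*} {p : ℝ} (h0 : 0 ≤ p) (h1 : p ≤ 1) (s : Finset ι)
    (P : ι → Finset α → Prop) :
    bernoulliProb p (fun S => ∃ i ∈ s, P i S) ≤ ∑ i ∈ s, bernoulliProb p (P i) := by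
  classical
  unfold bernoulliProb
  rw [sum_comm]
  refine sum_le_sum fun S _ => ?_
  rw [← mul_sum]
  refine mul_le_mul_of_nonneg_left ?_ (bernoulliWeight_nonneg h0 h1 S)
  split_ifs with h
  · obtain ⟨i, hi, hP⟩ := h
    calc (1 : ℝ) = if P i S then 1 else 0 := by simp [hP]
      _ ≤ _ := single_le_sum (f := fun i => if P i S then (1 : ℝ) else 0)
        (fun j _ => by split_ifs <;> simp) hi
  · exact sum_nonneg fun j _ => by split_ifs <;> simp

lemma bernoulliProb_and_add_and_not (p : ℝ) (P Q : Finset α → Prop) :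
    bernoulliProb p (fun S => P S ∧ Q S) + bernoulliProb p (fun S => P S ∧ ¬ Q S) =
      bernoulliProb p P := by
  unfold bernoulliProb
  rw [← sum_add_distrib]
  refine sum_congr rfl fun S _ => ?_
  rw [← mul_add]
  by_cases hP : P S <;> by_cases hQ : Q S <;> simp [hP, hQ]

lemma bernoulliProb_disjoint (p : ℝ) (K : Finset α) :
    bernoulliProb p (fun S => Disjoint S K) = (1 - p) ^ #K := by
  classical
  have h : ∀ S : Finset α, (bernoulliWeight p S * if Disjoint S K then 1 else 0) =
      ∏ x, if x ∈ S then (if x ∈ K then 0 else p) else 1 - p := by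
    intro S
    split_ifs with hS
    · rw [mul_one]
      refine prod_congr rfl fun x _ => ?_
      by_cases hx : x ∈ S
      · simp [hx, disjoint_left.1 hS hx]
      · simp [hx]
    · obtain ⟨x, hx, hK⟩ := not_disjoint_iff.1 hS
      rw [mul_zero, eq_comm]
      exact prod_eq_zero (mem_univ x) (by simp [hx, hK])
  unfold bernoulliProb
  convert sum_prod_ite_mem (fun x => if x ∈ K then 0 else p) (fun _ => 1 - p) using 1
  · exact sum_congr rfl fun S _ => by convert h S
  · trans ∏ x, if x ∈ K then 1 - p else 1
    · simp [prod_ite_mem]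
    · refine prod_congr rfl fun x _ => ?_
      by_cases hx : x ∈ K <;> simp [hx]

lemma bernoulliProb_subset (p : ℝ) (K : Finset α) :
    bernoulliProb p (fun S => K ⊆ S) = p ^ #K := by
  have h := bernoulliProb_disjoint (1 - p) K
  rw [sub_sub_cancel] at h
  rw [← h]
  unfold bernoulliProb
  refine sum_bij' (fun S _ => Sᶜ) (fun S _ => Sᶜ) (by simp) (by simp) (by simp) (by simp) ?_
  intro S _
  congr 1
  · refine prod_congr rfl fun x _ => ?_
    by_cases hx : x ∈ S <;> simp [hx]
  · simp only [disjoint_compl_left_iff]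
    congr

lemma bernoulliProb_disjoint_nonempty (p : ℝ) (K : Finset α) :
    bernoulliProb p (fun S => Disjoint S K ∧ S.Nonempty) =
      (1 - p) ^ #K - (1 - p) ^ Fintype.card α := by
  have h : bernoulliProb p (fun S => Disjoint S K ∧ ¬ S.Nonempty) = (1 - p) ^ Fintype.card α := by
    rw [← card_univ, ← bernoulliProb_disjoint p (univ : Finset α)]
    refine congrArg _ (funext fun S => propext ?_)
    rw [not_nonempty_iff_eq_empty]
    constructor
    · rintro ⟨-, rfl⟩
      simp
    · intro h
      have : S = ∅ := by simpa [disjoint_left, eq_empty_iff_forall_notMem] using h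
      simp [this]
  rw [eq_sub_iff_add_eq, ← h, bernoulliProb_and_add_and_not, bernoulliProb_disjoint]

lemma bernoulliProb_two_le_card_inter_le {p : ℝ} (h0 : 0 ≤ p) (h1 : p ≤ 1) (A : Finset α) :
    bernoulliProb p (fun S => 2 ≤ #(S ∩ A)) ≤ (#A * p) ^ 2 := by
  calc bernoulliProb p (fun S => 2 ≤ #(S ∩ A))
      ≤ bernoulliProb p (fun S => ∃ B ∈ A.powersetCard 2, B ⊆ S) := by
        refine bernoulliProb_mono h0 h1 fun S hS => ?_
        obtain ⟨B, hB, hB2⟩ := exists_subset_card_eq hS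
        exact ⟨B, mem_powersetCard.2 ⟨hB.trans inter_subset_right, hB2⟩,
          hB.trans inter_subset_left⟩
    _ ≤ ∑ B ∈ A.powersetCard 2, bernoulliProb p (fun S => B ⊆ S) :=
        bernoulliProb_exists_le h0 h1 _ _
    _ = ∑ B ∈ A.powersetCard 2, p ^ 2 := by
        refine sum_congr rfl fun B hB => ?_
        rw [bernoulliProb_subset, (mem_powersetCard.1 hB).2]
    _ = (#A).choose 2 * p ^ 2 := by simp
    _ ≤ (#A * p) ^ 2 := by
        rw [mul_pow]
        gcongr
        exact_mod_cast Nat.choose_le_pow _ _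

/-- The rows of a random subset of a product are independent random subsets. -/
lemma bernoulliProb_forall_rowOf [Fintype β] [DecidableEq β] (p : ℝ) (P : α → Finset β → Prop) :
    bernoulliProb p (fun E : Finset (α × β) => ∀ a, P a (rowOf E a)) =
      ∏ a, bernoulliProb p (P a) := by
  classical
  unfold bernoulliProb
  rw [Fintype.prod_sum]
  refine sum_bij' (fun E _ a => rowOf E a)
    (fun R _ => univ.filter fun x : α × β => x.2 ∈ R x.1) (by simp) (by simp) ?_ ?_ ?_
  · intro E _; ext ⟨a, b⟩; simp
  · intro R _; ext a b; simp
  · intro E _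
    rw [prod_mul_distrib]
    congr 1
    · simp [bernoulliWeight, Fintype.prod_prod_type]
    · rw [prod_boole]; simp

/-- The distribution of a random subset of a product is invariant under swapping the factors. -/
lemma bernoulliProb_swap [Fintype β] [DecidableEq β] (p : ℝ) (P : Finset (α × β) → Prop) :
    bernoulliProb p (fun E : Finset (β × α) => P (E.map (Equiv.prodComm β α).toEmbedding)) =
      bernoulliProb p P := by
  classical
  unfold bernoulliProb
  refine Fintype.sum_equiv (Equiv.finsetCongr (Equiv.prodComm β α)) _ _ fun E => ?_
  congr 1
  unfold bernoulliWeight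
  refine Fintype.prod_equiv (Equiv.prodComm β α) _ _ fun x => ?_
  simp

/-- Inclusion–exclusion over the empty columns of a random square array. -/
lemma bernoulliProb_forall_nonempty (n : ℕ) (p : ℝ) :
    bernoulliProb p (fun E : Finset (Fin n × Fin n) =>
        (∀ u, (rowOf E u).Nonempty) ∧ ∀ v, (colOf E v).Nonempty) =
      ∑ k ∈ range (n + 1),
        (-1) ^ k * (n.choose k * ((1 - p) ^ n) ^ k) * (1 - (1 - p) ^ (n - k)) ^ n := by
  classical
  have key : ∀ E : Finset (Fin n × Fin n),
      (if (∀ u, (rowOf E u).Nonempty) ∧ ∀ v, (colOf E v).Nonempty then (1 : ℝ) else 0) =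
      ∑ K : Finset (Fin n), (-1) ^ #K *
        if ∀ u, Disjoint (rowOf E u) K ∧ (rowOf E u).Nonempty then 1 else 0 := by
    intro E
    by_cases hr : ∀ u, (rowOf E u).Nonempty
    · have h1 : (if ∀ v, (colOf E v).Nonempty then (1 : ℝ) else 0) =
          ∏ v, (1 - if (colOf E v) = ∅ then 1 else 0) := by
        trans ∏ v, if (colOf E v).Nonempty then (1 : ℝ) else 0
        · rw [prod_boole]; simp
        refine prod_congr rfl fun v _ => ?_
        by_cases h : colOf E v = ∅
        · simp [h]
        · simp [h, nonempty_iff_ne_empty]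
      simp only [hr, implies_true, true_and, and_true]
      rw [h1, prod_sub, powerset_univ]
      refine sum_congr rfl fun K _ => ?_
      rw [prod_boole]
      simp only [prod_const_one, mul_one]
      congr 2
      apply propext
      simp only [disjoint_left, mem_rowOf, eq_empty_iff_forall_notMem, mem_colOf]
      exact ⟨fun h u v huv hv => h v hv u huv, fun h v hv u huv => h u huv hv⟩
    · have h2 : ∀ K : Finset (Fin n),
          ¬ ∀ u, Disjoint (rowOf E u) K ∧ (rowOf E u).Nonempty :=
        fun K h => hr fun u => (h u).2
      simp [hr, h2]
  calc _ = ∑ K : Finset (Fin n), (-1) ^ #K * bernoulliProb p (fun E : Finset (Fin n × Fin n) =>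
        ∀ u, Disjoint (rowOf E u) K ∧ (rowOf E u).Nonempty) := by
        unfold bernoulliProb
        simp_rw [mul_sum]
        rw [sum_comm]
        refine sum_congr rfl fun E _ => ?_
        trans bernoulliWeight p E * ∑ K : Finset (Fin n), (-1) ^ #K *
          if ∀ u, Disjoint (rowOf E u) K ∧ (rowOf E u).Nonempty then 1 else 0
        · rw [← key E]; congr
        rw [mul_sum]
        refine sum_congr rfl fun K _ => ?_
        rw [mul_left_comm]; congr
    _ = ∑ K ∈ (univ : Finset (Fin n)).powerset,
        (-1) ^ #K * ((1 - p) ^ #K - (1 - p) ^ n) ^ n := by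
        rw [powerset_univ]
        refine sum_congr rfl fun K _ => ?_
        rw [bernoulliProb_forall_rowOf p fun _ C => Disjoint C K ∧ C.Nonempty]
        simp [bernoulliProb_disjoint_nonempty]
    _ = _ := by
        rw [sum_powerset_apply_card (fun k => (-1 : ℝ) ^ k * ((1 - p) ^ k - (1 - p) ^ n) ^ n),
          card_univ, Fintype.card_fin]
        refine sum_congr rfl fun k hk => ?_
        have hk : k ≤ n := by simpa [Nat.lt_succ_iff] using hk
        have : (1 - p) ^ n = (1 - p) ^ k * (1 - p) ^ (n - k) := by
          rw [← pow_add, Nat.add_sub_cancel' hk]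
        rw [nsmul_eq_mul, show (1 - p) ^ k - (1 - p) ^ n = (1 - p) ^ k * (1 - (1 - p) ^ (n - k)) by
          rw [this]; ring, mul_pow, ← pow_mul, ← pow_mul, mul_comm k n]
        ring

end BernoulliSubsets

section HallObstructions

variable {n : ℕ}

/-- Each row of `E` indexed by `J` meets the set `A` of columns at least twice, and no other
row of `E` meets `A`. -/
def IsObstruction (E : Finset (Fin n × Fin n)) (A J : Finset (Fin n)) : Prop :=
  ∀ u, if u ∈ J then 2 ≤ #(rowOf E u ∩ A) else Disjoint (rowOf E u) A

/-- The reversed digraph. -/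
abbrev reverse (E : Finset (Fin n × Fin n)) : Finset (Fin n × Fin n) :=
  E.map (Equiv.prodComm _ _).toEmbedding

lemma rightNbhd_reverse (E : Finset (Fin n × Fin n)) (A : Finset (Fin n)) :
    rightNbhd n (reverse E) A = leftNbhd n E A := by
  ext; simp [rightNbhd, leftNbhd]

lemma leftNbhd_reverse (E : Finset (Fin n × Fin n)) (A : Finset (Fin n)) :
    leftNbhd n (reverse E) A = rightNbhd n E A := by
  ext; simp [rightNbhd, leftNbhd]

lemma hasHamiltonianDecomposition_iff (E : Finset (Fin n × Fin n)) :
    HasHamiltonianDecomposition n E ↔ ∀ A, #A ≤ #(leftNbhd n E A) := by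
  classical
  have h := Fintype.all_card_le_filter_rel_iff_exists_injective fun u v : Fin n => (u, v) ∈ E
  have h' : (∀ A, #A ≤ #(leftNbhd n E A)) ↔
      ∃ f : Fin n → Fin n, Function.Injective f ∧ ∀ u, (u, f u) ∈ E := by
    rw [← h]
    unfold leftNbhd
    congr!
  rw [h']
  constructor
  · rintro ⟨σ, hσ⟩
    exact ⟨σ, σ.injective, hσ⟩
  · rintro ⟨f, hf, hfE⟩
    exact ⟨Equiv.ofBijective f (Finite.injective_iff_bijective.1 hf), hfE⟩

/-- The columns violating Hall's condition, if there are as few of them as possible on either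
side, form an obstruction with their neighborhood. -/
lemma isObstruction_of_minimal {E : Finset (Fin n × Fin n)} {A : Finset (Fin n)}
    (hcol : ∀ v, (colOf E v).Nonempty) (hA : #(rightNbhd n E A) < #A)
    (hr : ∀ B : Finset (Fin n), #B < #A → #B ≤ #(rightNbhd n E B))
    (hl : ∀ B : Finset (Fin n), #B < #A → #B ≤ #(leftNbhd n E B)) :
    2 ≤ #A ∧ 2 * #A ≤ n + 1 ∧ #(rightNbhd n E A) = #A - 1 ∧
      IsObstruction E A (rightNbhd n E A) := by
  classical
  have hmono : ∀ B ⊆ A, rightNbhd n E B ⊆ rightNbhd n E A := by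
    intro B hB u hu
    simp only [rightNbhd, mem_filter, mem_univ, true_and] at hu ⊢
    obtain ⟨v, hv, h⟩ := hu
    exact ⟨v, hB hv, h⟩
  have herase : ∀ a ∈ A, #A - 1 ≤ #(rightNbhd n E (A.erase a)) := by
    intro a ha
    have := hr (A.erase a) (card_erase_lt_of_mem ha)
    rwa [card_erase_of_mem ha] at this
  obtain ⟨a, ha⟩ : A.Nonempty := card_pos.1 (by omega)
  have hcard : #(rightNbhd n E A) = #A - 1 := by
    have h1 := card_le_card (hmono _ (erase_subset a A))
    have h2 := herase a ha
    omega
  have hne : (rightNbhd n E A).Nonempty := by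
    obtain ⟨u, hu⟩ := hcol a
    exact ⟨u, by simpa [rightNbhd] using ⟨a, ha, by simpa using hu⟩⟩
  refine ⟨?_, ?_, hcard, ?_⟩
  · have := card_pos.2 hne
    omega
  · by_contra! hlt
    have hc : #(rightNbhd n E A)ᶜ = n - #(rightNbhd n E A) := by simp [card_compl]
    have h1 := hl (rightNbhd n E A)ᶜ (by omega)
    have h2 : leftNbhd n E (rightNbhd n E A)ᶜ ⊆ Aᶜ := by
      intro v hv
      simp only [leftNbhd, rightNbhd, mem_filter, mem_univ, true_and, mem_compl] at hv ⊢
      obtain ⟨u, hu, h⟩ := hv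
      exact fun hvA => hu ⟨v, hvA, h⟩
    have h3 := card_le_card h2
    have h4 : #Aᶜ = n - #A := by simp [card_compl]
    have h5 : #A ≤ n := by simpa using card_le_univ A
    omega
  · intro u
    split_ifs with hu
    · have hu' := hu
      simp only [rightNbhd, mem_filter, mem_univ, true_and] at hu'
      obtain ⟨v, hv, huv⟩ := hu'
      by_contra! hlt
      have hsingle : ∀ w ∈ A, (u, w) ∈ E → w = v := fun w hw huw =>
        card_le_one.1 (Nat.lt_succ_iff.1 hlt) w (by simp [hw, huw]) v (by simp [hv, huv])
      have hsub : rightNbhd n E (A.erase v) ⊆ (rightNbhd n E A).erase u := by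
        intro x hx
        refine mem_erase.2 ⟨?_, hmono _ (erase_subset v A) hx⟩
        rintro rfl
        simp only [rightNbhd, mem_filter, mem_univ, true_and, mem_erase] at hx
        obtain ⟨w, ⟨hwv, hw⟩, h⟩ := hx
        exact hwv (hsingle w hw h)
      have h1 := card_le_card hsub
      rw [card_erase_of_mem hu] at h1
      have h2 := herase v hv
      have := card_pos.2 hne
      omega
    · rw [disjoint_left]
      intro v hv hvA
      exact hu (by simpa [rightNbhd] using ⟨v, hvA, by simpa using hv⟩)

lemma exists_isObstruction {E : Finset (Fin n × Fin n)}
    (hrow : ∀ u, (rowOf E u).Nonempty) (hcol : ∀ v, (colOf E v).Nonempty)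
    (hE : ¬ HasHamiltonianDecomposition n E) :
    ∃ k ∈ (Icc 2 n).filter (2 * · ≤ n + 1), ∃ A ∈ powersetCard k univ,
      ∃ J ∈ powersetCard (k - 1) univ, IsObstruction E A J ∨ IsObstruction (reverse E) A J := by
  classical
  have hex : ∃ k, ∃ A : Finset (Fin n), #A = k ∧
      (#(rightNbhd n E A) < k ∨ #(leftNbhd n E A) < k) := by
    rw [hasHamiltonianDecomposition_iff] at hE
    push Not at hE
    obtain ⟨A, hA⟩ := hE
    exact ⟨_, A, rfl, .inr hA⟩
  have hmin : ∀ B : Finset (Fin n), #B < Nat.find hex →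
      #B ≤ #(rightNbhd n E B) ∧ #B ≤ #(leftNbhd n E B) := by
    intro B hB
    have := Nat.find_min hex hB
    push Not at this
    exact this B rfl
  obtain ⟨A, hAk, hA⟩ := Nat.find_spec hex
  rw [← hAk] at hA hmin
  have hAn : #A ≤ n := by simpa using card_le_univ A
  rcases hA with hA | hA
  · obtain ⟨h2, hn, hJ, hO⟩ := isObstruction_of_minimal hcol hA
      (fun B hB => (hmin B hB).1) (fun B hB => (hmin B hB).2)
    exact ⟨#A, by simp [h2, hn, hAn], A, by simp, _, by simpa using hJ, .inl hO⟩
  · have hcol' : ∀ v, (colOf (reverse E) v).Nonempty := by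
      intro v
      obtain ⟨w, hw⟩ := hrow v
      exact ⟨w, by simpa using hw⟩
    rw [← rightNbhd_reverse] at hA
    obtain ⟨h2, hn, hJ, hO⟩ := isObstruction_of_minimal hcol' hA
      (fun B hB => by rw [rightNbhd_reverse]; exact (hmin B hB).2)
      (fun B hB => by rw [leftNbhd_reverse]; exact (hmin B hB).1)
    exact ⟨#A, by simp [h2, hn, hAn], A, by simp, _, by simpa using hJ, .inr hO⟩

lemma bernoulliProb_isObstruction_le {p : ℝ} (h0 : 0 ≤ p) (h1 : p ≤ 1) (A J : Finset (Fin n)) :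
    bernoulliProb p (fun E => IsObstruction E A J) ≤
      ((#A * p) ^ 2) ^ #J * ((1 - p) ^ #A) ^ (n - #J) := by
  have h := bernoulliProb_forall_rowOf (α := Fin n) p fun u C =>
    if u ∈ J then 2 ≤ #(C ∩ A) else Disjoint C A
  unfold IsObstruction
  rw [h]
  calc _ ≤ ∏ u, if u ∈ J then (#A * p) ^ 2 else (1 - p) ^ #A := by
        refine prod_le_prod (fun u _ => bernoulliProb_nonneg h0 h1 _) fun u _ => ?_
        split_ifs
        · exact bernoulliProb_two_le_card_inter_le h0 h1 A
        · exact (bernoulliProb_disjoint p A).le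
    _ = _ := by
        have : univ.filter (· ∉ J) = Jᶜ := by ext; simp
        rw [prod_ite, prod_const, prod_const, this, card_compl, Fintype.card_fin]
        simp

lemma bernoulliProb_not_hasHamiltonianDecomposition_le {p : ℝ} (h0 : 0 ≤ p) (h1 : p ≤ 1) :
    bernoulliProb p (fun E : Finset (Fin n × Fin n) =>
        ((∀ u, (rowOf E u).Nonempty) ∧ ∀ v, (colOf E v).Nonempty) ∧
          ¬ HasHamiltonianDecomposition n E) ≤
      ∑ k ∈ (Icc 2 n).filter (2 * · ≤ n + 1), n.choose k * (n.choose (k - 1) *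
        (2 * (((k * p) ^ 2) ^ (k - 1) * ((1 - p) ^ k) ^ (n - (k - 1))))) := by
  refine (bernoulliProb_mono h0 h1 fun E hE => exists_isObstruction hE.1.1 hE.1.2 hE.2).trans ?_
  refine (bernoulliProb_exists_le h0 h1 _ _).trans (sum_le_sum fun k _ => ?_)
  refine (bernoulliProb_exists_le h0 h1 _ _).trans ?_
  refine (sum_le_card_nsmul _ _ (n.choose (k - 1) *
        (2 * (((k * p) ^ 2) ^ (k - 1) * ((1 - p) ^ k) ^ (n - (k - 1)))) : ℝ)
        fun A hA => ?_).trans (by simp)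
  refine (bernoulliProb_exists_le h0 h1 _ _).trans ?_
  refine (sum_le_card_nsmul _ _
        (2 * (((k * p) ^ 2) ^ (k - 1) * ((1 - p) ^ k) ^ (n - (k - 1))) : ℝ)
        fun J hJ => ?_).trans (by simp)
  refine (bernoulliProb_or_le h0 h1 _ _).trans ?_
  rw [bernoulliProb_swap p fun E => IsObstruction E A J]
  have h := bernoulliProb_isObstruction_le h0 h1 A J
  rw [(mem_powersetCard.1 hA).2, (mem_powersetCard.1 hJ).2] at h
  linarith

end HallObstructions

section Asymptotics

lemma choose_mul_obstruction_bound_le {n j : ℕ} {p C D : ℝ} (hn : 0 < n) (h0 : 0 ≤ p) (h1 : p ≤ 1)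
    (hC : Real.exp (-(n * p)) ≤ C / n) (hD : Real.exp (n * p / 2) ≤ D * √n)
    (hj : 2 * (j + 1) ≤ n + 1) :
    n.choose (j + 1) * (n.choose j *
      (2 * (((((j + 1 : ℕ) : ℝ) * p) ^ 2) ^ j * ((1 - p) ^ (j + 1)) ^ (n - j)))) ≤
      2 * Real.exp 2 * C * (Real.exp 3 * C * D * ((n * p) ^ 2 / √n)) ^ j := by
  have hn' : (0 : ℝ) < n := by exact_mod_cast hn
  have hs : 0 < √(n : ℝ) := Real.sqrt_pos.2 hn'
  have hss : √(n : ℝ) * √n = n := Real.mul_self_sqrt hn'.le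
  have hCn : 0 ≤ C / n := (Real.exp_pos _).le.trans hC
  have hC0 : 0 ≤ C := by
    have := mul_nonneg hCn hn'.le
    rwa [div_mul_cancel₀ _ hn'.ne'] at this
  have hj' : (2 : ℝ) * (j + 1) ≤ n + 1 := by exact_mod_cast hj
  have hchoose1 : (n.choose (j + 1) : ℝ) ≤ n ^ (j + 1) / j.factorial := by
    refine (Nat.choose_le_pow_div (j + 1) n).trans ?_
    gcongr
    exact Nat.le_succ j
  have hchoose2 : (n.choose j : ℝ) ≤ n ^ j / j.factorial := Nat.choose_le_pow_div j n
  have hfac : (((j + 1 : ℕ) : ℝ)) ^ j / j.factorial ≤ Real.exp (j + 1) := by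
    have := Real.pow_div_factorial_le_exp (x := ((j + 1 : ℕ) : ℝ)) (by positivity) j
    simpa using this
  have hq : (1 - p) ^ (n - j) ≤ C / n * Real.exp (p * j) := by
    have hjn : j ≤ n := by omega
    calc (1 - p) ^ (n - j) ≤ Real.exp (-p) ^ (n - j) := by
          gcongr
          linarith [Real.add_one_le_exp (-p)]
      _ = Real.exp (-(n * p)) * Real.exp (p * j) := by
          rw [← Real.exp_nat_mul, ← Real.exp_add, Nat.cast_sub hjn]
          ring_nf
      _ ≤ _ := by gcongr
  have hexp : Real.exp (p * (j + 1)) ≤ Real.exp 1 * (D * √n) := by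
    calc Real.exp (p * (j + 1)) ≤ Real.exp (1 + n * p / 2) := by
          apply Real.exp_le_exp.2
          nlinarith
      _ = Real.exp 1 * Real.exp (n * p / 2) := Real.exp_add _ _
      _ ≤ _ := by gcongr
  have hq' : ((1 - p) ^ (j + 1)) ^ (n - j) ≤
      (C / n) ^ (j + 1) * (Real.exp 1 * (D * √n)) ^ j := by
    calc ((1 - p) ^ (j + 1)) ^ (n - j) = ((1 - p) ^ (n - j)) ^ (j + 1) := by
          rw [← pow_mul, ← pow_mul, mul_comm]
      _ ≤ (C / n * Real.exp (p * j)) ^ (j + 1) := by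
          gcongr
      _ = (C / n) ^ (j + 1) * (Real.exp (p * (j + 1))) ^ j := by
          rw [mul_pow, ← Real.exp_nat_mul, ← Real.exp_nat_mul]
          push_cast
          ring_nf
      _ ≤ _ := by gcongr
  have hq0 : 0 ≤ 1 - p := by linarith
  calc _ ≤ (n : ℝ) ^ (j + 1) / j.factorial * (n ^ j / j.factorial *
        (2 * (((((j + 1 : ℕ) : ℝ) * p) ^ 2) ^ j *
          ((C / n) ^ (j + 1) * (Real.exp 1 * (D * √n)) ^ j)))) := by
        gcongr
    _ = (n : ℝ) ^ (2 * j + 1) * p ^ (2 * j) * 2 *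
        ((C / n) ^ (j + 1) * (Real.exp 1 * (D * √n)) ^ j) *
        ((((j + 1 : ℕ) : ℝ)) ^ j / j.factorial) ^ 2 := by
        simp only [mul_pow, div_pow, ← pow_mul]
        ring
    _ ≤ (n : ℝ) ^ (2 * j + 1) * p ^ (2 * j) * 2 *
        ((C / n) ^ (j + 1) * (Real.exp 1 * (D * √n)) ^ j) * Real.exp (j + 1) ^ 2 := by
        have : 0 ≤ Real.exp 1 * (D * √n) := (Real.exp_pos _).le.trans hexp
        gcongr
    _ = _ := by
        have e1 : Real.exp (j + 1) ^ 2 = Real.exp 2 * Real.exp 2 ^ j := by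
          rw [← Real.exp_nat_mul, ← Real.exp_nat_mul, ← Real.exp_add]
          push_cast
          ring_nf
        have e2 : Real.exp 3 = Real.exp 2 * Real.exp 1 := by
          rw [← Real.exp_add]
          norm_num
        have e3 : (n : ℝ) ^ (2 * j + 1) * (C / n) ^ (j + 1) = C * (n * C) ^ j := by
          rw [div_pow, pow_succ C, mul_pow, show 2 * j + 1 = j + (j + 1) by ring, pow_add _ j]
          field_simp
        have e4 : (n * p) ^ 2 / √n = n * p ^ 2 * √n := by
          rw [div_eq_iff hs.ne', mul_assoc _ (√(n : ℝ)), hss]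
          ring
        rw [e1, e2, e4]
        calc _ = ((n : ℝ) ^ (2 * j + 1) * (C / n) ^ (j + 1)) * p ^ (2 * j) * 2 *
              (Real.exp 1 * (D * √n)) ^ j * (Real.exp 2 * Real.exp 2 ^ j) := by ring
          _ = _ := by
            rw [e3, pow_mul]
            simp only [mul_pow]
            ring

variable {c : ℝ} {p : ℕ → ℝ}

lemma tendsto_mul_div_rpow_quarter
    (hlim : Tendsto (fun n : ℕ => (n : ℝ) * p n - Real.log n) atTop (nhds c)) :
    Tendsto (fun n : ℕ => (n : ℝ) * p n / (n : ℝ) ^ (1 / 4 : ℝ)) atTop (nhds 0) := by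
  have h1 : Tendsto (fun n : ℕ => (n : ℝ) ^ (1 / 4 : ℝ)) atTop atTop :=
    (tendsto_rpow_atTop (by norm_num)).comp tendsto_natCast_atTop_atTop
  have h2 : Tendsto (fun n : ℕ => Real.log n / (n : ℝ) ^ (1 / 4 : ℝ)) atTop (nhds 0) :=
    (isLittleO_log_rpow_atTop (r := 1 / 4) (by norm_num)).tendsto_div_nhds_zero.comp
      tendsto_natCast_atTop_atTop
  have h3 := (hlim.div_atTop h1).add h2
  rw [add_zero] at h3
  refine h3.congr fun n => ?_
  ring

lemma tendsto_sq_mul_div_sqrt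
    (hlim : Tendsto (fun n : ℕ => (n : ℝ) * p n - Real.log n) atTop (nhds c)) :
    Tendsto (fun n : ℕ => ((n : ℝ) * p n) ^ 2 / √n) atTop (nhds 0) := by
  have h := (tendsto_mul_div_rpow_quarter hlim).pow 2
  rw [zero_pow two_ne_zero] at h
  refine h.congr fun n => ?_
  rw [div_pow, ← Real.rpow_mul_natCast (Nat.cast_nonneg n), Real.sqrt_eq_rpow]
  norm_num

lemma tendsto_edge_prob
    (hlim : Tendsto (fun n : ℕ => (n : ℝ) * p n - Real.log n) atTop (nhds c)) :
    Tendsto p atTop (nhds 0) := by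
  have h1 : Tendsto (fun n : ℕ => (n : ℝ) ^ (3 / 4 : ℝ)) atTop atTop :=
    (tendsto_rpow_atTop (by norm_num)).comp tendsto_natCast_atTop_atTop
  refine ((tendsto_mul_div_rpow_quarter hlim).div_atTop h1).congr' ?_
  filter_upwards [eventually_gt_atTop 0] with n hn
  have hn' : (0 : ℝ) < n := by exact_mod_cast hn
  rw [div_div, ← Real.rpow_add hn']
  norm_num
  field_simp

/-- The expected number of empty rows converges. -/
lemma tendsto_mul_one_sub_pow
    (hlim : Tendsto (fun n : ℕ => (n : ℝ) * p n - Real.log n) atTop (nhds c)) :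
    Tendsto (fun n : ℕ => (n : ℝ) * (1 - p n) ^ n) atTop (nhds (Real.exp (-c))) := by
  have hp0 := tendsto_edge_prob hlim
  have hsq : Tendsto (fun n : ℕ => (n : ℝ) * p n * p n) atTop (nhds 0) := by
    have h1 : Tendsto (fun n : ℕ => √(n : ℝ)) atTop atTop :=
      Real.tendsto_sqrt_atTop.comp tendsto_natCast_atTop_atTop
    refine ((tendsto_sq_mul_div_sqrt hlim).div_atTop h1).congr' ?_
    filter_upwards [eventually_gt_atTop 0] with n hn
    have hn' : (0 : ℝ) < n := by exact_mod_cast hn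
    rw [div_div, Real.mul_self_sqrt hn'.le]
    field_simp
  have hlow : Tendsto (fun n : ℕ => -((n : ℝ) * p n - Real.log n) -
      (n : ℝ) * p n * p n / (1 - p n)) atTop (nhds (-c)) := by
    have := hlim.neg.sub (hsq.div (tendsto_const_nhds.sub hp0) (by norm_num : (1 : ℝ) - 0 ≠ 0))
    simpa using this
  have hlt : ∀ᶠ n in atTop, p n < 1 := hp0.eventually_lt_const (by norm_num)
  have hlog : Tendsto (fun n : ℕ => Real.log n + n * Real.log (1 - p n)) atTop (nhds (-c)) := by
    refine tendsto_of_tendsto_of_tendsto_of_le_of_le' hlow hlim.neg ?_ ?_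
    · filter_upwards [hlt] with n hn
      have hq : 0 < 1 - p n := by linarith
      have h := mul_le_mul_of_nonneg_left (Real.one_sub_inv_le_log_of_pos hq) (Nat.cast_nonneg n)
      have e : (n : ℝ) * (1 - (1 - p n)⁻¹) = -(n * p n) - n * p n * p n / (1 - p n) := by
        field_simp
        ring
      linarith
    · filter_upwards [hlt] with n hn
      have hq : 0 < 1 - p n := by linarith
      have h := mul_le_mul_of_nonneg_left (Real.log_le_sub_one_of_pos hq) (Nat.cast_nonneg n)
      linarith
  refine ((Real.continuous_exp.tendsto _).comp hlog).congr' ?_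
  filter_upwards [hlt, eventually_gt_atTop 0] with n hn hn0
  have hq : 0 < 1 - p n := by linarith
  have hn' : (0 : ℝ) < n := by exact_mod_cast hn0
  simp only [Function.comp_apply]
  rw [Real.exp_add, Real.exp_log hn', Real.exp_nat_mul, Real.exp_log hq]

lemma tendsto_bernoulliProb_forall_nonempty (hp : ∀ n, p n ∈ Set.Icc (0 : ℝ) 1)
    (hlim : Tendsto (fun n : ℕ => (n : ℝ) * p n - Real.log n) atTop (nhds c)) :
    Tendsto (fun n : ℕ => bernoulliProb (p n) (fun E : Finset (Fin n × Fin n) =>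
        (∀ u, (rowOf E u).Nonempty) ∧ ∀ v, (colOf E v).Nonempty)) atTop
      (nhds (Real.exp (-(2 * Real.exp (-c))))) := by
  have hq := tendsto_mul_one_sub_pow hlim
  have hp0 := tendsto_edge_prob hlim
  have hlt : ∀ᶠ n in atTop, p n < 1 := hp0.eventually_lt_const (by norm_num)
  set t := Real.exp (-c) with ht
  have ht0 : 0 < t := Real.exp_pos _
  have hterm : ∀ k : ℕ, Tendsto (fun n : ℕ =>
      (-1 : ℝ) ^ k * (n.choose k * ((1 - p n) ^ n) ^ k) * (1 - (1 - p n) ^ (n - k)) ^ n) atTop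
      (nhds ((-1) ^ k * (t ^ k / k.factorial) * Real.exp (-t))) := by
    intro k
    refine (Tendsto.const_mul _
      (ProbabilityTheory.tendsto_choose_mul_pow_atTop k hq)).mul ?_
    have h1 : Tendsto (fun n : ℕ => (n : ℝ) * -(1 - p n) ^ (n - k)) atTop (nhds (-t)) := by
      have h2 : Tendsto (fun n => (1 - p n) ^ k) atTop (nhds 1) := by
        simpa using ((tendsto_const_nhds (x := (1 : ℝ))).sub hp0).pow k
      have h3 := (hq.div h2 one_ne_zero).neg
      rw [div_one] at h3
      refine h3.congr' ?_
      filter_upwards [hlt, eventually_ge_atTop k] with n hn hk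
      have hq : 0 < 1 - p n := by linarith
      have : (1 - p n) ^ n = (1 - p n) ^ k * (1 - p n) ^ (n - k) := by
        rw [← pow_add, Nat.add_sub_cancel' hk]
      simp only [Pi.div_apply]
      rw [this]
      field_simp
    simpa [sub_eq_add_neg] using Real.tendsto_one_add_pow_exp_of_tendsto h1
  have hsum := tendsto_tsum_of_dominated_convergence (𝓕 := atTop)
    (bound := fun k : ℕ => (t + 1) ^ k / k.factorial)
    (Real.summable_pow_div_factorial (t + 1)) hterm ?_
  · have hval : ∑' k : ℕ, (-1 : ℝ) ^ k * (t ^ k / k.factorial) * Real.exp (-t) =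
        Real.exp (-(2 * t)) := by
      have : ∀ k : ℕ, (-1 : ℝ) ^ k * (t ^ k / k.factorial) = (-t) ^ k / k.factorial := by
        intro k
        rw [neg_pow t]
        ring
      simp_rw [this]
      rw [tsum_mul_right, ← congrFun NormedSpace.exp_eq_tsum_div, ← Real.exp_eq_exp_ℝ,
        ← Real.exp_add]
      ring_nf
    rw [hval] at hsum
    refine hsum.congr fun n => ?_
    rw [bernoulliProb_forall_nonempty, tsum_eq_sum]
    intro k hk
    have : n < k := by simpa [Nat.lt_succ_iff] using hk
    simp [Nat.choose_eq_zero_of_lt this]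
  · filter_upwards [hq.eventually_le_const (lt_add_one t)] with n hn k
    have h0 : 0 ≤ 1 - p n := by linarith [(hp n).2]
    have h1 : 1 - p n ≤ 1 := by linarith [(hp n).1]
    have h2 : 0 ≤ (1 - (1 - p n) ^ (n - k)) ^ n :=
      pow_nonneg (sub_nonneg.2 (pow_le_one₀ h0 h1)) _
    have h3 : (1 - (1 - p n) ^ (n - k)) ^ n ≤ 1 :=
      pow_le_one₀ (sub_nonneg.2 (pow_le_one₀ h0 h1)) (sub_le_self _ (pow_nonneg h0 _))
    have h4 : (0 : ℝ) ≤ n.choose k * ((1 - p n) ^ n) ^ k := by positivity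
    rw [norm_mul, norm_mul, norm_pow, norm_neg, norm_one, one_pow, one_mul,
      Real.norm_of_nonneg h4, Real.norm_of_nonneg h2]
    calc _ ≤ (n.choose k * ((1 - p n) ^ n) ^ k : ℝ) * 1 := by gcongr
      _ ≤ (n ^ k / k.factorial) * ((1 - p n) ^ n) ^ k := by
          rw [mul_one]
          gcongr
          exact Nat.choose_le_pow_div k n
      _ = (n * (1 - p n) ^ n) ^ k / k.factorial := by
          rw [mul_pow]
          ring
      _ ≤ _ := by gcongr

lemma tendsto_bernoulliProb_not_hasHamiltonianDecomposition (hp : ∀ n, p n ∈ Set.Icc (0 : ℝ) 1)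
    (hlim : Tendsto (fun n : ℕ => (n : ℝ) * p n - Real.log n) atTop (nhds c)) :
    Tendsto (fun n : ℕ => bernoulliProb (p n) (fun E : Finset (Fin n × Fin n) =>
        ((∀ u, (rowOf E u).Nonempty) ∧ ∀ v, (colOf E v).Nonempty) ∧
          ¬ HasHamiltonianDecomposition n E)) atTop (nhds 0) := by
  set C := Real.exp (1 - c)
  set D := Real.exp ((c + 1) / 2)
  set B := 2 * Real.exp 2 * C
  set r : ℕ → ℝ := fun n => Real.exp 3 * C * D * ((n * p n) ^ 2 / √n) with hr
  have hr0 : Tendsto r atTop (nhds 0) := by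
    simpa using (tendsto_sq_mul_div_sqrt hlim).const_mul (Real.exp 3 * C * D)
  have hbound : Tendsto (fun n => 8 * B * r n) atTop (nhds 0) := by
    simpa using hr0.const_mul (8 * B)
  refine squeeze_zero' (.of_forall fun n => bernoulliProb_nonneg (hp n).1 (hp n).2 _) ?_ hbound
  filter_upwards [hlim.eventually_le_const (lt_add_one c),
    hlim.eventually_const_le (sub_one_lt c), hr0.eventually_le_const (by norm_num : (0 : ℝ) < 1 / 2),
    eventually_gt_atTop 0] with n hu hl hrn hn
  have hn' : (0 : ℝ) < n := by exact_mod_cast hn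
  have hC : Real.exp (-(n * p n)) ≤ C / n := by
    rw [← Real.exp_log hn', ← Real.exp_sub, Real.exp_log hn']
    apply Real.exp_le_exp.2
    linarith
  have hD : Real.exp (n * p n / 2) ≤ D * √n := by
    rw [← Real.exp_log (Real.sqrt_pos.2 hn'), ← Real.exp_add, Real.log_sqrt hn'.le]
    apply Real.exp_le_exp.2
    linarith
  have hB0 : 0 ≤ B := by positivity
  have hrn0 : 0 ≤ r n := by positivity
  refine (bernoulliProb_not_hasHamiltonianDecomposition_le (hp n).1 (hp n).2).trans ?_
  calc _ ≤ ∑ k ∈ (Icc 2 n).filter (2 * · ≤ n + 1), 4 * B * r n * (1 / 2) ^ k := by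
        refine sum_le_sum fun k hk => ?_
        simp only [mem_filter, mem_Icc] at hk
        obtain ⟨i, rfl⟩ : ∃ i, k = i + 2 := ⟨k - 2, by omega⟩
        refine (choose_mul_obstruction_bound_le (j := i + 1) hn (hp n).1 (hp n).2 hC hD
          hk.2).trans ?_
        calc B * r n ^ (i + 1) = B * r n * r n ^ i := by ring
          _ ≤ B * r n * (1 / 2) ^ i := by gcongr
          _ = 4 * B * r n * (1 / 2) ^ (i + 2) := by ring
    _ = 4 * B * r n * ∑ k ∈ (Icc 2 n).filter (2 * · ≤ n + 1), (1 / 2 : ℝ) ^ k := by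
        rw [mul_sum]
    _ ≤ 4 * B * r n * 2 := by
        gcongr
        exact (summable_geometric_two.sum_le_tsum _ fun k _ => by positivity).trans_eq
          tsum_geometric_two
    _ = 8 * B * r n := by ring

end Asymptotics

lemma digraphProb_eq_bernoulliProb (n : ℕ) (p : ℝ) (P : Finset (Fin n × Fin n) → Prop) :
    digraphProb n p p {E | P E} = bernoulliProb p P := by
  unfold digraphProb bernoulliProb
  refine sum_congr rfl fun E _ => ?_
  have h : bernoulliWeight p E = (∏ e ∈ E, p) * ∏ e ∈ univ \ E, (1 - p) := by
    unfold bernoulliWeight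
    rw [prod_ite]
    congr 1 <;> refine prod_congr ?_ fun _ _ => rfl <;> ext <;> simp
  by_cases hP : P E <;> simp [hP, h, Set.indicator]

lemma HasHamiltonianDecomposition.nonempty {n : ℕ} {E : Finset (Fin n × Fin n)}
    (h : HasHamiltonianDecomposition n E) :
    (∀ u, (rowOf E u).Nonempty) ∧ ∀ v, (colOf E v).Nonempty := by
  obtain ⟨σ, hσ⟩ := h
  exact ⟨fun u => ⟨σ u, by simpa using hσ u⟩,
    fun v => ⟨σ.symm v, by simpa using hσ (σ.symm v)⟩⟩

/-- If `n·p_n - log n → c`, the probability that a digraph drawn from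
`G(n, p_n)` admits a Hamiltonian decomposition converges to `exp(-2·exp(-c))`. -/
theorem prob_hamiltonianDecomposition_tendsto (c : ℝ) (p : ℕ → ℝ)
    (hp : ∀ n, p n ∈ Set.Icc (0 : ℝ) 1)
    (hlim : Tendsto (fun n : ℕ => (n : ℝ) * p n - Real.log n) atTop (nhds c)) :
    Tendsto (fun n : ℕ =>
        digraphProb n (p n) (p n) {E | HasHamiltonianDecomposition n E}) atTop
      (nhds (Real.exp (-(2 * Real.exp (-c))))) := by
  have h := (tendsto_bernoulliProb_forall_nonempty hp hlim).sub
    (tendsto_bernoulliProb_not_hasHamiltonianDecomposition hp hlim)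
  rw [sub_zero] at h
  refine h.congr fun n => ?_
  rw [digraphProb_eq_bernoulliProb, sub_eq_iff_eq_add,
    ← bernoulliProb_and_add_and_not (p n) _ (HasHamiltonianDecomposition n)]
  congr 2
  funext E
  exact propext ⟨fun h => h.2, fun h => ⟨h.nonempty, h⟩⟩
end
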